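/- Let SO(3) = {B ∈ M₃(ℝ) : BᵀB = I, det B = 1}, a compact topological group with the topology inherited from the 3×3 real matrices, and let μ be its normalized Haar probability measure. Then the pushforward of μ under the map B ↦ B₃₃ (the (3,3) matrix entry) equals the uniform probability measure on [−1, 1], i.e. one half of Lebesgue measure restricted to [−1, 1]. -/

import Mathlib

open MeasureTheory Matrix
open scoped ENNReal


noncomputable instance : MeasurableSpace (Matrix (Fin 3) (Fin 3) ℝ) :=
  borel (Matrix (Fin 3) (Fin 3) ℝ)

instance : BorelSpace (Matrix (Fin 3) (Fin 3) ℝ) := ⟨rfl⟩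

/-- If the law of `(X, Z)` in the unit square is invariant under plane rotations, then
`∫ Z ^ (n + 1) = n * ∫ X ^ 2 * Z ^ (n - 1)`. -/
lemma integral_rotation_generator_eq_zero {Ω : Type*} [MeasurableSpace Ω] (μ : Measure Ω)
    [IsFiniteMeasure μ] (X Z : Ω → ℝ) (hX : Measurable X) (hZ : Measurable Z)
    (hX1 : ∀ᵐ ω ∂μ, |X ω| ≤ 1) (hZ1 : ∀ᵐ ω ∂μ, |Z ω| ≤ 1) (n : ℕ)
    (hrot : ∀ t : ℝ, ∫ ω, (Real.cos t * X ω + Real.sin t * Z ω) *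
        (-Real.sin t * X ω + Real.cos t * Z ω) ^ n ∂μ = ∫ ω, X ω * Z ω ^ n ∂μ) :
    ∫ ω, (Z ω ^ (n + 1) - n * (X ω ^ 2 * Z ω ^ (n - 1))) ∂μ = 0 := by
  let D : ℝ → ℝ → ℝ → ℝ := fun t x z =>
    (-Real.sin t * x + Real.cos t * z) * (-Real.sin t * x + Real.cos t * z) ^ n +
      (Real.cos t * x + Real.sin t * z) *
        (n * (-Real.sin t * x + Real.cos t * z) ^ (n - 1) *
          (-Real.cos t * x + -Real.sin t * z))
  obtain ⟨C, hC⟩ := ((isCompact_Icc (a := (-1 : ℝ)) (b := 1)).prod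
    ((isCompact_Icc (a := (-1 : ℝ)) (b := 1)).prod
      (isCompact_Icc (a := (-1 : ℝ)) (b := 1)))).exists_bound_of_continuousOn
      (f := fun p : ℝ × ℝ × ℝ => D p.1 p.2.1 p.2.2) (by fun_prop)
  have hint : Integrable (fun ω => (Real.cos 0 * X ω + Real.sin 0 * Z ω) *
        (-Real.sin 0 * X ω + Real.cos 0 * Z ω) ^ n) μ := by
    refine Integrable.of_bound (by fun_prop) 1 ?_
    filter_upwards [hX1, hZ1] with ω hx hz
    simp only [Real.cos_zero, Real.sin_zero, one_mul, zero_mul, neg_zero, zero_add, add_zero,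
      Real.norm_eq_abs, abs_mul, abs_pow]
    exact mul_le_one₀ hx (by positivity) (pow_le_one₀ (abs_nonneg _) hz)
  have key := hasDerivAt_integral_of_dominated_loc_of_deriv_le (μ := μ) (x₀ := (0 : ℝ))
    (F := fun t ω => (Real.cos t * X ω + Real.sin t * Z ω) *
        (-Real.sin t * X ω + Real.cos t * Z ω) ^ n)
    (F' := fun t ω => D t (X ω) (Z ω)) (bound := fun _ => C) (s := Set.Icc (-1) 1)
    (Icc_mem_nhds (by norm_num) (by norm_num))
    (Filter.Eventually.of_forall fun t => by fun_prop) hint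
    (by simp only [D]; fun_prop)
    (by
      filter_upwards [hX1, hZ1] with ω hx hz t ht
      exact hC (t, X ω, Z ω) ⟨ht, abs_le.1 hx, abs_le.1 hz⟩)
    (integrable_const C)
    (Filter.Eventually.of_forall fun ω t _ =>
      (((Real.hasDerivAt_cos t).mul_const (X ω)).add
        ((Real.hasDerivAt_sin t).mul_const (Z ω))).mul
      ((((Real.hasDerivAt_sin t).neg.mul_const (X ω)).add
        ((Real.hasDerivAt_cos t).mul_const (Z ω))).pow n))
  have h0 := key.2
  simp only [hrot] at h0
  rw [← h0.unique (hasDerivAt_const _ _)]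
  refine integral_congr_ae (Filter.Eventually.of_forall fun ω => ?_)
  simp only [D, Real.cos_zero, Real.sin_zero]
  ring

/-- Finite measures carried by `[-1, 1]` are determined by their moments. -/
lemma measure_ext_of_forall_integral_pow_eq (μ ν : Measure ℝ) [IsFiniteMeasure μ]
    [IsFiniteMeasure ν] (hμ : ∀ᵐ x ∂μ, x ∈ Set.Icc (-1 : ℝ) 1)
    (hν : ∀ᵐ x ∂ν, x ∈ Set.Icc (-1 : ℝ) 1)
    (h : ∀ n : ℕ, ∫ x, x ^ n ∂μ = ∫ x, x ^ n ∂ν) : μ = ν := by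
  have hint : ∀ ρ : Measure ℝ, IsFiniteMeasure ρ → (∀ᵐ x ∂ρ, x ∈ Set.Icc (-1 : ℝ) 1) →
      ∀ f : ℝ → ℝ, Continuous f → Integrable f ρ := by
    intro ρ _ hρ f hf
    obtain ⟨C, hC⟩ := (isCompact_Icc (a := (-1 : ℝ)) (b := 1)).exists_bound_of_continuousOn
      hf.continuousOn
    exact Integrable.of_bound hf.aestronglyMeasurable C (hρ.mono fun x hx => hC x hx)
  have hpoly : ∀ p : Polynomial ℝ, ∫ x, p.eval x ∂μ = ∫ x, p.eval x ∂ν := by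
    intro p
    simp only [Polynomial.eval_eq_sum_range]
    rw [integral_finsetSum _ fun i _ => hint μ ‹_› hμ _ (by fun_prop),
      integral_finsetSum _ fun i _ => hint ν ‹_› hν _ (by fun_prop)]
    simp only [integral_const_mul, h]
  refine ext_of_forall_integral_eq_of_IsFiniteMeasure fun f => ?_
  have hclose : ∀ ρ : Measure ℝ, IsFiniteMeasure ρ → (∀ᵐ x ∂ρ, x ∈ Set.Icc (-1 : ℝ) 1) →
      ∀ (p : Polynomial ℝ) (ε : ℝ), (∀ x ∈ Set.Icc (-1 : ℝ) 1, |p.eval x - f x| < ε) →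
      |∫ x, p.eval x ∂ρ - ∫ x, f x ∂ρ| ≤ ε * ρ.real Set.univ := by
    intro ρ _ hρ p ε hp
    rw [← integral_sub (hint ρ ‹_› hρ _ p.continuous) (hint ρ ‹_› hρ _ f.continuous)]
    have hbound : ∀ᵐ x ∂ρ, ‖p.eval x - f x‖ ≤ ε := hρ.mono fun x hx => (hp x hx).le
    exact norm_integral_le_of_norm_le_const hbound
  refine eq_of_forall_dist_le fun ε hε => ?_
  set M := μ.real Set.univ + ν.real Set.univ + 1
  have hM : 0 < M := by positivity
  obtain ⟨p, hp⟩ := exists_polynomial_near_of_continuousOn (-1) 1 f f.continuous.continuousOn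
    (ε / M) (by positivity)
  have h1 := hclose μ ‹_› hμ p _ hp
  have h2 := hclose ν ‹_› hν p _ hp
  rw [hpoly p, abs_sub_comm] at h1
  have h3 : ε / M * M = ε := by field_simp
  have h4 : 0 < ε / M := by positivity
  rw [Real.dist_eq]
  refine (abs_sub_le _ (∫ x, p.eval x ∂ν) _).trans ?_
  simp only [M, mul_add, mul_one] at h3
  linarith

/-- Closed form of a sequence satisfying the moment recursion of the uniform law on `[-1, 1]`. -/
lemma moment_eq_of_recursion (m : ℕ → ℝ) (h0 : m 0 = 1) (h1 : m 1 = 0)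
    (hrec : ∀ n : ℕ, (n + 3) * m (n + 2) = (n + 1) * m n) (n : ℕ) :
    m n = (1 - (-1) ^ (n + 1)) / (2 * (n + 1)) := by
  induction n using Nat.twoStepInduction with
  | zero => norm_num [h0]
  | one => norm_num [h1]
  | more n ih _ =>
    have hn : (n + 3 : ℝ) ≠ 0 := by positivity
    have h := hrec n
    rw [ih] at h
    have : m (n + 2) = (1 - (-1) ^ (n + 1)) / (2 * (n + 3)) := by
      field_simp at h ⊢
      linarith
    rw [this]
    push_cast
    ring

/-- Let `SO(3) = {B ∈ M₃(ℝ) : BᵀB = I, det B = 1}`, a compact topological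
group with the topology inherited from the 3×3 real matrices, and let `μ` be its normalized Haar
probability measure (formalized as: a Borel probability measure on `M₃(ℝ)` concentrated on
`SO(3)` and invariant under left and right translation by elements of `SO(3)`).  Then the
pushforward of `μ` under the map `B ↦ B₃₃` (the `(3,3)` matrix entry) equals the uniform
probability measure on `[−1, 1]`, i.e. one half of Lebesgue measure restricted to `[−1, 1]`. -/
theorem so3_haar_entry33_uniform
    (μ : Measure (Matrix (Fin 3) (Fin 3) ℝ)) [IsProbabilityMeasure μ]
    (hconc : μ ({B : Matrix (Fin 3) (Fin 3) ℝ | Bᵀ * B = 1 ∧ B.det = 1}ᶜ) = 0)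
    (hinv : ∀ A : Matrix (Fin 3) (Fin 3) ℝ, Aᵀ * A = 1 → A.det = 1 →
      μ.map (fun B => A * B) = μ ∧ μ.map (fun B => B * A) = μ) :
    μ.map (fun B : Matrix (Fin 3) (Fin 3) ℝ => B 2 2)
      = (2⁻¹ : ℝ≥0∞) • volume.restrict (Set.Icc (-1 : ℝ) 1) := by
  have hcont : ∀ i j : Fin 3, Continuous fun B : Matrix (Fin 3) (Fin 3) ℝ => B i j :=
    fun i j => continuous_id.matrix_elem i j
  have hmeas : ∀ i j : Fin 3, Measurable fun B : Matrix (Fin 3) (Fin 3) ℝ => B i j :=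
    fun i j => (hcont i j).measurable
  have hsphere : ∀ᵐ B ∂μ, B 0 2 ^ 2 + B 1 2 ^ 2 + B 2 2 ^ 2 = 1 := by
    have hSO : ∀ᵐ B ∂μ, Bᵀ * B = 1 ∧ B.det = 1 := hconc
    filter_upwards [hSO] with B hB
    have h22 := congrFun (congrFun hB.1 2) 2
    simp only [Matrix.mul_apply, Fin.sum_univ_three, Matrix.transpose_apply,
      Matrix.one_apply_eq] at h22
    linarith
  have hle : ∀ i : Fin 3, ∀ᵐ B ∂μ, |B i 2| ≤ 1 := by
    intro i
    filter_upwards [hsphere] with B hB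
    rw [← sq_le_one_iff_abs_le_one]
    fin_cases i <;> simp only [Fin.zero_eta, Fin.mk_one, Fin.reduceFinMk] <;>
      linarith [sq_nonneg (B 0 2), sq_nonneg (B 1 2), sq_nonneg (B 2 2)]
  have hint : ∀ (i : Fin 3) (k n : ℕ), Integrable (fun B => B i 2 ^ k * B 2 2 ^ n) μ := by
    intro i k n
    have hm1 := hmeas i 2
    have hm2 := hmeas 2 2
    refine Integrable.of_bound (by fun_prop) 1 ?_
    filter_upwards [hle i, hle 2] with B hx hz
    simp only [Real.norm_eq_abs, abs_mul, abs_pow]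
    exact mul_le_one₀ (pow_le_one₀ (abs_nonneg _) hx) (by positivity)
      (pow_le_one₀ (abs_nonneg _) hz)
  have hleft : ∀ A : Matrix (Fin 3) (Fin 3) ℝ, Aᵀ * A = 1 → A.det = 1 →
      ∀ f : Matrix (Fin 3) (Fin 3) ℝ → ℝ, Continuous f →
        ∫ B, f (A * B) ∂μ = ∫ B, f B ∂μ := by
    intro A hA hdet f hf
    have hmul : Measurable fun B : Matrix (Fin 3) (Fin 3) ℝ => A * B :=
      (continuous_const.matrix_mul continuous_id).measurable
    conv_rhs => rw [← (hinv A hA hdet).1]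
    exact (integral_map hmul.aemeasurable hf.aestronglyMeasurable).symm
  have hgen0 : ∀ n : ℕ, ∫ B, (B 2 2 ^ (n + 1) - n * (B 0 2 ^ 2 * B 2 2 ^ (n - 1))) ∂μ = 0 := by
    intro n
    refine integral_rotation_generator_eq_zero μ _ _ (hmeas 0 2) (hmeas 2 2) (hle 0) (hle 2) n
      fun t => ?_
    have hct := Real.sin_sq_add_cos_sq t
    have hR := hleft !![Real.cos t, 0, Real.sin t; 0, 1, 0; -Real.sin t, 0, Real.cos t]
      (by
        ext i j
        fin_cases i <;> fin_cases j <;>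
          simp [Matrix.mul_apply, Fin.sum_univ_three] <;> linarith)
      (by simp [Matrix.det_fin_three]; linarith)
      (fun B => B 0 2 * B 2 2 ^ n) ((hcont 0 2).mul ((hcont 2 2).pow n))
    rw [← hR]
    simp [Matrix.mul_apply, Fin.sum_univ_three]
  have hgen1 : ∀ n : ℕ, ∫ B, (B 2 2 ^ (n + 1) - n * (B 1 2 ^ 2 * B 2 2 ^ (n - 1))) ∂μ = 0 := by
    intro n
    refine integral_rotation_generator_eq_zero μ _ _ (hmeas 1 2) (hmeas 2 2) (hle 1) (hle 2) n
      fun t => ?_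
    have hct := Real.sin_sq_add_cos_sq t
    have hR := hleft !![1, 0, 0; 0, Real.cos t, Real.sin t; 0, -Real.sin t, Real.cos t]
      (by
        ext i j
        fin_cases i <;> fin_cases j <;>
          simp [Matrix.mul_apply, Fin.sum_univ_three] <;> linarith)
      (by simp [Matrix.det_fin_three]; linarith)
      (fun B => B 1 2 * B 2 2 ^ n) ((hcont 1 2).mul ((hcont 2 2).pow n))
    rw [← hR]
    simp [Matrix.mul_apply, Fin.sum_univ_three]
  have hpow : ∀ n : ℕ, Integrable (fun B => B 2 2 ^ n) μ := by
    intro n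
    simpa using hint 0 0 n
  have hmoment := moment_eq_of_recursion (fun n => ∫ B, B 2 2 ^ n ∂μ) (by simp)
    (by simpa using hgen0 0) (by
      intro n
      have e0 := hgen0 (n + 1)
      have e1 := hgen1 (n + 1)
      rw [integral_sub (hpow _) ((hint 0 2 _).const_mul _), integral_const_mul] at e0
      rw [integral_sub (hpow _) ((hint 1 2 _).const_mul _), integral_const_mul] at e1
      simp only [Nat.add_sub_cancel] at e0 e1
      have e2 : ∫ B, B 2 2 ^ n ∂μ = ∫ B, B 0 2 ^ 2 * B 2 2 ^ n ∂μ +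
          ∫ B, B 1 2 ^ 2 * B 2 2 ^ n ∂μ + ∫ B, B 2 2 ^ (n + 2) ∂μ := by
        have hsum := integral_add ((hint 0 2 n).add (hint 1 2 n)) (hpow (n + 2))
        simp only [Pi.add_apply] at hsum
        rw [← integral_add (hint 0 2 n) (hint 1 2 n), ← hsum]
        refine integral_congr_ae ?_
        filter_upwards [hsphere] with B hB
        linear_combination (-B 2 2 ^ n) * hB
      push_cast at e0 e1
      linear_combination e0 + e1 - (n + 1) * e2)
  have : IsProbabilityMeasure (μ.map (fun B : Matrix (Fin 3) (Fin 3) ℝ => B 2 2)) :=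
    Measure.isProbabilityMeasure_map (hmeas 2 2).aemeasurable
  have : IsFiniteMeasure ((2⁻¹ : ℝ≥0∞) • volume.restrict (Set.Icc (-1 : ℝ) 1)) :=
    Measure.smul_finite _ (by simp)
  refine measure_ext_of_forall_integral_pow_eq _ _ ?_ ?_ fun n => ?_
  · exact (ae_map_iff (hmeas 2 2).aemeasurable measurableSet_Icc).2
      ((hle 2).mono fun B hB => abs_le.1 hB)
  · exact Measure.ae_smul_measure (ae_restrict_mem measurableSet_Icc) _
  · rw [integral_map (hmeas 2 2).aemeasurable (by fun_prop), integral_smul_measure,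
      integral_Icc_eq_integral_Ioc, ← intervalIntegral.integral_of_le (by norm_num),
      integral_pow]
    rw [hmoment n]
    simp
    field_simp
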